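/- The function x ↦ (3x² − 3i·x − 2)/((x − i)⁴·(x + i)³), viewed as a map from ℝ to ℂ, is integrable on ℝ, and its integral over ℝ equals −5πi/8. (This is the normal-direction integral arising from the trace expression tr[B₃ × ∂_{ξ_n}σ_{−3}] in equation (5.34) of case (b) for the twisted signature operator.) -/

import Mathlib

open Complex MeasureTheory

lemma ofReal_sub_I_ne_zero (x : ℝ) : (x : ℂ) - I ≠ 0 := fun h => by
  simpa using congrArg Complex.im h

lemma ofReal_add_I_ne_zero (x : ℝ) : (x : ℂ) + I ≠ 0 := fun h => by
  simpa using congrArg Complex.im h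

lemma norm_ofReal_add_I_sq (x : ℝ) : ‖(x : ℂ) + I‖ ^ 2 = 1 + x ^ 2 := by
  rw [Complex.sq_norm, Complex.normSq_apply]
  simp
  ring

lemma norm_ofReal_sub_I (x : ℝ) : ‖(x : ℂ) - I‖ = ‖(x : ℂ) + I‖ := by
  rw [← Complex.norm_conj]
  simp

lemma integrable_rational :
    Integrable (fun x : ℝ => (3 * (x : ℂ) ^ 2 - 3 * I * (x : ℂ) - 2) /
      (((x : ℂ) - I) ^ 4 * ((x : ℂ) + I) ^ 3)) := by
  refine (integrable_inv_one_add_sq.const_mul 8).mono' ?_ (.of_forall fun x => ?_)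
  · refine Continuous.aestronglyMeasurable (Continuous.div (by fun_prop) (by fun_prop) fun x => ?_)
    exact mul_ne_zero (pow_ne_zero _ (ofReal_sub_I_ne_zero x))
      (pow_ne_zero _ (ofReal_add_I_ne_zero x))
  · have hA := norm_ofReal_add_I_sq x
    rw [norm_div, norm_mul, norm_pow, norm_pow, norm_ofReal_sub_I, ← hA]
    have hnum : ‖3 * (x : ℂ) ^ 2 - 3 * I * (x : ℂ) - 2‖ ≤ 3 * |x| ^ 2 + 3 * |x| + 2 :=
      (norm_sub_le _ _).trans (add_le_add ((norm_sub_le _ _).trans (by simp)) (by simp))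
    set A := ‖(x : ℂ) + I‖
    have hA1 : 1 ≤ A := by
      have : 0 ≤ A := norm_nonneg _
      nlinarith [sq_nonneg x]
    have hnum' : ‖3 * (x : ℂ) ^ 2 - 3 * I * (x : ℂ) - 2‖ ≤ 8 * A ^ 2 := by
      rw [hA]
      nlinarith [sq_nonneg (|x| - 1), sq_abs x]
    rw [← div_eq_mul_inv, div_le_div_iff₀ (by positivity) (by positivity)]
    have h : A ^ 4 ≤ A ^ 7 := pow_le_pow_right₀ hA1 (by norm_num)
    nlinarith [mul_le_mul_of_nonneg_right hnum' (sq_nonneg A)]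

/-- The rational part of a primitive of the integrand, from its partial fraction decomposition. -/
noncomputable def rationalPart (x : ℝ) : ℂ :=
  I / 12 * ((x : ℂ) - I)⁻¹ ^ 3 - 3 * I / 16 * ((x : ℂ) - I)⁻¹ +
    1 / 4 * ((x : ℂ) + I)⁻¹ ^ 2 - 7 * I / 16 * ((x : ℂ) + I)⁻¹

lemma hasDerivAt_primitive (x : ℝ) :
    HasDerivAt (fun x : ℝ => rationalPart x - 5 * I / 8 * (Real.arctan x : ℂ))
      ((3 * (x : ℂ) ^ 2 - 3 * I * (x : ℂ) - 2) /
        (((x : ℂ) - I) ^ 4 * ((x : ℂ) + I) ^ 3)) x := by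
  have hm := ofReal_sub_I_ne_zero x
  have hp := ofReal_add_I_ne_zero x
  have hx : HasDerivAt (fun y : ℝ => (y : ℂ)) 1 x := by
    simpa using (hasDerivAt_id x).ofReal_comp
  have hsub := (hx.sub_const I).fun_inv hm
  have hadd := (hx.add_const I).fun_inv hp
  have hatan := (Real.hasDerivAt_arctan x).ofReal_comp
  have hderiv := (((((hsub.fun_pow 3).const_mul (I / 12)).sub (hsub.const_mul (3 * I / 16))).add
    ((hadd.fun_pow 2).const_mul (1 / 4))).sub (hadd.const_mul (7 * I / 16))).sub
    (hatan.const_mul (5 * I / 8))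
  refine hderiv.congr_deriv ?_
  have hfac : (1 : ℂ) + (x : ℂ) ^ 2 = ((x : ℂ) - I) * ((x : ℂ) + I) := by
    linear_combination I_sq
  push_cast
  rw [hfac]
  obtain ⟨t, ht⟩ : ∃ t, t = (x : ℂ) - I := ⟨_, rfl⟩
  have hxt : (x : ℂ) = t + I := by rw [ht]; ring
  rw [← ht] at hm ⊢
  rw [hxt] at hp ⊢
  field_simp
  ring_nf
  simp only [show I ^ 3 = -I by rw [pow_succ, I_sq]; ring, I_sq, I_pow_four]
  ring

lemma tendsto_inv_ofReal_add_const {l : Filter ℝ}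
    (hl : Filter.Tendsto (fun x : ℝ => ‖x‖) l Filter.atTop) (c : ℂ) :
    Filter.Tendsto (fun x : ℝ => ((x : ℂ) + c)⁻¹) l (nhds 0) := by
  refine Filter.tendsto_inv₀_cobounded.comp (tendsto_norm_atTop_iff_cobounded.mp ?_)
  refine Filter.tendsto_atTop_mono (fun x => ?_) (Filter.tendsto_atTop_add_const_right l (-‖c‖) hl)
  have := norm_sub_le ((x : ℂ) + c) c
  rw [add_sub_cancel_right, Complex.norm_real] at this
  linarith

lemma tendsto_rationalPart {l : Filter ℝ}
    (hl : Filter.Tendsto (fun x : ℝ => ‖x‖) l Filter.atTop) :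
    Filter.Tendsto rationalPart l (nhds 0) := by
  have hp := tendsto_inv_ofReal_add_const hl I
  have hm := tendsto_inv_ofReal_add_const hl (-I)
  simp only [← sub_eq_add_neg] at hm
  have h := ((((hm.pow 3).const_mul (I / 12)).sub (hm.const_mul (3 * I / 16))).add
    ((hp.pow 2).const_mul (1 / 4))).sub (hp.const_mul (7 * I / 16))
  have hzero : I / 12 * 0 ^ 3 - 3 * I / 16 * 0 + 1 / 4 * 0 ^ 2 - 7 * I / 16 * 0 = 0 := by ring
  rw [hzero] at h
  exact h

theorem stmt_11 :
    MeasureTheory.Integrable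
      (fun x : ℝ => (3 * (x : ℂ)^2 - 3 * I * (x : ℂ) - 2) / (((x : ℂ) - I) ^ 4 * ((x : ℂ) + I) ^ 3)) ∧
    ∫ x : ℝ, (3 * (x : ℂ)^2 - 3 * I * (x : ℂ) - 2) / (((x : ℂ) - I) ^ 4 * ((x : ℂ) + I) ^ 3) = -(5 * (Real.pi : ℂ) * I / 8) := by
  refine ⟨integrable_rational, ?_⟩
  have htop := (Complex.continuous_ofReal.tendsto _).comp
    (Real.tendsto_arctan_atTop.mono_right nhdsWithin_le_nhds)
  have hbot := (Complex.continuous_ofReal.tendsto _).comp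
    (Real.tendsto_arctan_atBot.mono_right nhdsWithin_le_nhds)
  rw [integral_of_hasDerivAt_of_tendsto hasDerivAt_primitive integrable_rational
    ((tendsto_rationalPart Filter.tendsto_abs_atBot_atTop).sub (hbot.const_mul (5 * I / 8)))
    ((tendsto_rationalPart Filter.tendsto_abs_atTop_atTop).sub (htop.const_mul (5 * I / 8)))]
  push_cast
  ring
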